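/- arXiv:2306.04111 — 5 statements merged into one kernel-verified Lean document; each statement's English description precedes it below -/
import Mathlib

section
/- Let p ≥ 1, let B be a symmetric positive definite real p×p matrix and let s, y ∈ ℝᵖ with sᵀy > 0. Then the BFGS-updated matrix B' := B + (sᵀy)⁻¹ y yᵀ − (sᵀB s)⁻¹ (B s)(B s)ᵀ is symmetric positive definite. (Note that sᵀB s > 0 since s ≠ 0.) -/
open Matrix

/-- The BFGS update `B' = B + (sᵀy)⁻¹ y yᵀ - (sᵀBs)⁻¹ (Bs)(Bs)ᵀ` of a symmetric
positive definite approximate Hessian `B` is symmetric positive definite, provided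
`sᵀy > 0`. -/
theorem bfgs_hessian_posDef {p : ℕ} (hp : 1 ≤ p)
    (B : Matrix (Fin p) (Fin p) ℝ) (hB : B.PosDef)
    (s y : Fin p → ℝ) (hsy : 0 < s ⬝ᵥ y) :
    (B + (s ⬝ᵥ y)⁻¹ • vecMulVec y y
        - (s ⬝ᵥ B.mulVec s)⁻¹ • vecMulVec (B.mulVec s) (B.mulVec s)).PosDef := by
  have hpos : ∀ x : Fin p → ℝ, x ≠ 0 → 0 < x ⬝ᵥ B *ᵥ x := fun x hx => by
    simpa using hB.dotProduct_mulVec_pos hx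
  have hT : Bᵀ = B := by
    rw [← conjTranspose_eq_transpose_of_trivial]
    exact hB.1
  have hsymm : ∀ u v : Fin p → ℝ, u ⬝ᵥ B *ᵥ v = v ⬝ᵥ B *ᵥ u := fun u v => by
    rw [dotProduct_mulVec, dotProduct_comm, ← mulVec_transpose, hT]
  have hs : s ≠ 0 := by
    rintro rfl
    simp at hsy
  have ha := hpos s hs
  refine PosDef.of_dotProduct_mulVec_pos ?_ fun x hx => ?_
  · have hv : ∀ v : Fin p → ℝ, (vecMulVec v v)ᵀ = vecMulVec v v := fun v => by
      rw [transpose_vecMulVec]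
    rw [IsHermitian, conjTranspose_eq_transpose_of_trivial]
    simp only [transpose_sub, transpose_add, transpose_smul, hv, hT]
  · have key : star x ⬝ᵥ (B + (s ⬝ᵥ y)⁻¹ • vecMulVec y y
        - (s ⬝ᵥ B.mulVec s)⁻¹ • vecMulVec (B.mulVec s) (B.mulVec s)) *ᵥ x
        = x ⬝ᵥ B *ᵥ x + (s ⬝ᵥ y)⁻¹ * (x ⬝ᵥ y) ^ 2
          - (s ⬝ᵥ B *ᵥ s)⁻¹ * (x ⬝ᵥ B *ᵥ s) ^ 2 := by
      simp only [star_trivial, sub_mulVec, add_mulVec, smul_mulVec, vecMulVec_mulVec,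
        dotProduct_sub, dotProduct_add, dotProduct_smul, smul_eq_mul,
        op_smul_eq_smul, dotProduct_comm y x, dotProduct_comm (B *ᵥ s) x]
      ring
    rw [key]
    set a := s ⬝ᵥ B *ᵥ s with hadef
    set c := a⁻¹ * (x ⬝ᵥ B *ᵥ s) with hc
    have hz : (x - c • s) ⬝ᵥ B *ᵥ (x - c • s)
        = x ⬝ᵥ B *ᵥ x - a⁻¹ * (x ⬝ᵥ B *ᵥ s) ^ 2 := by
      simp only [mulVec_sub, mulVec_smul, dotProduct_sub, sub_dotProduct, dotProduct_smul,
        smul_dotProduct, smul_eq_mul, hsymm s x, ← hadef]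
      rw [hc]
      field_simp
      ring
    have hi : 0 < (s ⬝ᵥ y)⁻¹ := inv_pos.mpr hsy
    by_cases h0 : x - c • s = 0
    · have hxs : x = c • s := sub_eq_zero.mp h0
      have hc0 : c ≠ 0 := by
        intro h
        rw [h, zero_smul] at hxs
        exact hx hxs
      have hxy : x ⬝ᵥ y = c * (s ⬝ᵥ y) := by
        conv_lhs => rw [hxs]
        rw [smul_dotProduct, smul_eq_mul]
      have h1 : x ⬝ᵥ y ≠ 0 := by
        rw [hxy]
        exact mul_ne_zero hc0 hsy.ne'
      have h2 : 0 < (s ⬝ᵥ y)⁻¹ * (x ⬝ᵥ y) ^ 2 := by positivity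
      rw [h0, zero_dotProduct] at hz
      linarith
    · have h1 := hpos _ h0
      have h2 : 0 ≤ (s ⬝ᵥ y)⁻¹ * (x ⬝ᵥ y) ^ 2 := by positivity
      linarith
end

section
/- Let p ≥ 1, let B be a symmetric positive definite real p×p matrix with inverse H := B⁻¹, and let s, y ∈ ℝᵖ with sᵀy > 0. Then the BFGS-updated matrix B' := B + (sᵀy)⁻¹ y yᵀ − (sᵀB s)⁻¹ (B s)(B s)ᵀ is invertible, and its inverse equals the BFGS inverse-Hessian update of H: (B')⁻¹ = (I_p − ρ s yᵀ) H (I_p − ρ y sᵀ) + ρ s sᵀ, where ρ = (sᵀy)⁻¹. -/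
open Matrix

/-- The inverse of the BFGS update of a symmetric positive definite approximate
Hessian `B` equals the BFGS inverse-Hessian update of `H = B⁻¹`:
`(B')⁻¹ = (I - ρ s yᵀ) H (I - ρ y sᵀ) + ρ s sᵀ` with `ρ = (sᵀy)⁻¹`. -/
theorem bfgs_update_inverse {p : ℕ} (hp : 1 ≤ p)
    (B H : Matrix (Fin p) (Fin p) ℝ) (hB : B.PosDef) (hH : H = B⁻¹)
    (s y : Fin p → ℝ) (hsy : 0 < s ⬝ᵥ y)
    (ρ : ℝ) (hρ : ρ = (s ⬝ᵥ y)⁻¹) :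
    IsUnit (B + (s ⬝ᵥ y)⁻¹ • vecMulVec y y
        - (s ⬝ᵥ B.mulVec s)⁻¹ • vecMulVec (B.mulVec s) (B.mulVec s)) ∧
      (B + (s ⬝ᵥ y)⁻¹ • vecMulVec y y
        - (s ⬝ᵥ B.mulVec s)⁻¹ • vecMulVec (B.mulVec s) (B.mulVec s))⁻¹
        = (1 - ρ • vecMulVec s y) * H * (1 - ρ • vecMulVec y s)
          + ρ • vecMulVec s s := by
  have hs : s ≠ 0 := by
    rintro rfl
    simp at hsy
  have hsBs : 0 < s ⬝ᵥ B.mulVec s := by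
    simpa using hB.dotProduct_mulVec_pos hs
  have hdet : IsUnit B.det := hB.det_pos.ne'.isUnit
  have hBH : B * H = 1 := by rw [hH]; exact Matrix.mul_nonsing_inv B hdet
  have hT : Bᵀ = B := by
    have h := hB.isHermitian.eq
    rwa [Matrix.conjTranspose_eq_transpose_of_trivial] at h
  set w := B.mulVec s with hw
  have hwH : w ᵥ* H = s := by
    have h : w = s ᵥ* B := by rw [hw, ← Matrix.vecMul_transpose, hT]
    rw [h, Matrix.vecMul_vecMul, hBH, Matrix.vecMul_one]
  have hρ1 : ρ * (s ⬝ᵥ y) = 1 := by rw [hρ]; exact inv_mul_cancel₀ hsy.ne'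
  rw [← hρ]
  set β := (s ⬝ᵥ w)⁻¹ with hβ
  have hβ1 : β * (s ⬝ᵥ w) = 1 := inv_mul_cancel₀ hsBs.ne'
  have hsec : (B + ρ • vecMulVec y y - β • vecMulVec w w) *ᵥ s = y := by
    ext i
    have h1 : ρ * (y ⬝ᵥ s) = 1 := by rw [dotProduct_comm]; exact hρ1
    have h2 : β * (w ⬝ᵥ s) = 1 := by rw [dotProduct_comm]; exact hβ1
    simp only [Matrix.sub_mulVec, Matrix.add_mulVec, Matrix.smul_mulVec,
      Matrix.vecMulVec_mulVec, ← hw, Pi.add_apply, Pi.sub_apply, Pi.smul_apply,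
      smul_eq_mul, MulOpposite.smul_eq_mul_unop, MulOpposite.unop_op]
    linear_combination y i * h1 - w i * h2
  have key : (B + ρ • vecMulVec y y - β • vecMulVec w w) *
      ((1 - ρ • vecMulVec s y) * H * (1 - ρ • vecMulVec y s)
          + ρ • vecMulVec s s) = 1 := by
    have e1 : (B + ρ • vecMulVec y y - β • vecMulVec w w) * (1 - ρ • vecMulVec s y)
        = B - β • vecMulVec w w := by
      rw [mul_sub, mul_one, Matrix.mul_smul, Matrix.mul_vecMulVec, hsec]
      abel
    have e2 : (B - β • vecMulVec w w) * H = 1 - β • vecMulVec w s := by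
      rw [sub_mul, hBH, Matrix.smul_mul, Matrix.vecMulVec_mul, hwH]
    rw [mul_add, ← mul_assoc, ← mul_assoc, e1, e2, Matrix.mul_smul, Matrix.mul_vecMulVec, hsec,
      mul_sub, mul_one, Matrix.mul_smul, Matrix.mul_vecMulVec, Matrix.sub_mulVec,
      Matrix.one_mulVec, Matrix.smul_mulVec, Matrix.vecMulVec_mulVec]
    ext i j
    simp only [Matrix.add_apply, Matrix.sub_apply, Matrix.smul_apply, vecMulVec_apply,
      Pi.sub_apply, Pi.smul_apply,
      smul_eq_mul, MulOpposite.smul_eq_mul_unop, MulOpposite.unop_op]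
    linear_combination β * w i * s j * hρ1
  exact ⟨IsUnit.of_mul_eq_one _ key, Matrix.inv_eq_right_inv key⟩
end

section
/- Let p ≥ 1 and M ≥ 1, let A₁, …, A_M be invertible real p×p matrices, and suppose that their average A := M⁻¹ Σ_{m=1}^M A_m is also invertible. Then M⁻¹ Σ_{m=1}^M A_m⁻¹ − A⁻¹ = M⁻¹ Σ_{m=1}^M A_m⁻¹ (A − A_m) A⁻¹ (A − A_m) A⁻¹. -/
open Matrix

/-- The average of the inverses of matrices `A₁, …, A_M` differs from the inverse of
their average `A` only through terms quadratic in the deviations `A - A_m`. -/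
theorem average_inv_sub_inv_average {p M : ℕ} (hp : 1 ≤ p) (hM : 1 ≤ M)
    (A : Fin M → Matrix (Fin p) (Fin p) ℝ) (hA : ∀ m, IsUnit (A m))
    (Abar : Matrix (Fin p) (Fin p) ℝ) (hAbar : Abar = (M : ℝ)⁻¹ • ∑ m, A m)
    (hAbarUnit : IsUnit Abar) :
    (M : ℝ)⁻¹ • (∑ m, (A m)⁻¹) - Abar⁻¹
      = (M : ℝ)⁻¹ •
          ∑ m, (A m)⁻¹ * (Abar - A m) * Abar⁻¹ * (Abar - A m) * Abar⁻¹ := by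
  have hM0 : (M : ℝ) ≠ 0 := by
    have : M ≠ 0 := by omega
    exact_mod_cast this
  have hd : IsUnit Abar.det := (Matrix.isUnit_iff_isUnit_det _).1 hAbarUnit
  have hB1 : Abar * Abar⁻¹ = 1 := Matrix.mul_nonsing_inv _ hd
  have hB2 : Abar⁻¹ * Abar = 1 := Matrix.nonsing_inv_mul _ hd
  have hsum : ∑ m, A m = (M : ℝ) • Abar := by
    rw [hAbar, smul_smul, mul_inv_cancel₀ hM0, one_smul]
  have key : ∀ m, (A m)⁻¹ * (Abar - A m) * Abar⁻¹ * (Abar - A m) * Abar⁻¹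
      = (A m)⁻¹ - Abar⁻¹ - Abar⁻¹ + Abar⁻¹ * A m * Abar⁻¹ := by
    intro m
    have hm : (A m)⁻¹ * A m = 1 :=
      Matrix.nonsing_inv_mul _ ((Matrix.isUnit_iff_isUnit_det _).1 (hA m))
    have h1 : (A m)⁻¹ * (Abar - A m) * Abar⁻¹ = (A m)⁻¹ - Abar⁻¹ := by
      rw [mul_sub, sub_mul, hm, one_mul, mul_assoc, hB1, mul_one]
    rw [h1]
    simp only [mul_sub, sub_mul, hm, hB2, one_mul]
    rw [mul_assoc (A m)⁻¹, hB1, mul_one]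
    abel
  have hquad : ∑ m, Abar⁻¹ * A m * Abar⁻¹ = (M : ℝ) • Abar⁻¹ := by
    rw [← Finset.sum_mul, ← Finset.mul_sum, hsum, mul_smul_comm, hB2, smul_mul_assoc, one_mul]
  have hconst : ∑ _m : Fin M, Abar⁻¹ = (M : ℝ) • Abar⁻¹ := by
    simp [Nat.cast_smul_eq_nsmul]
  rw [Finset.sum_congr rfl (fun m _ => key m), Finset.sum_add_distrib, Finset.sum_sub_distrib,
    Finset.sum_sub_distrib, hquad, hconst, sub_add_cancel, smul_sub, smul_smul,
    inv_mul_cancel₀ hM0, one_smul]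
end

section
/- Let E be a finite-dimensional real inner product space and let f : E → ℝ be twice continuously differentiable. Let x* ∈ E satisfy ∇f(x*) = 0, let μ > 0 satisfy ⟨∇²f(x*) u, u⟩ ≥ μ ‖u‖² for all u ∈ E, and let C > 0 be such that ∇²f is Lipschitz with constant C (in operator norm) on the closed ball of radius μ/(2C) centered at x*. Then for every x with ‖x − x*‖ ≤ μ/(2C), the Hessian ∇²f(x) is invertible and the Newton iterate x⁺ := x − (∇²f(x))⁻¹ ∇f(x) satisfies ‖x⁺ − x*‖ ≤ (C/μ) ‖x − x*‖². -/
open scoped RealInnerProductSpace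

/-- Local quadratic convergence of one Newton step: if `∇f(x*) = 0`, the Hessian is
`μ`-positive definite at `x*` and `C`-Lipschitz on the ball of radius `μ/(2C)` around
`x*`, then for every `x` in that ball the Hessian `∇²f(x)` is invertible and the
Newton iterate `x⁺ = x - (∇²f(x))⁻¹ ∇f(x)` satisfies
`‖x⁺ - x*‖ ≤ (C/μ) ‖x - x*‖²`. -/
theorem newton_step_quadratic_convergence
    {E : Type*} [NormedAddCommGroup E] [InnerProductSpace ℝ E]
    [FiniteDimensional ℝ E]
    (f : E → ℝ) (g : E → E) (hess : E → E →L[ℝ] E)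
    (hg : ∀ x, HasGradientAt f (g x) x)
    (hhess : ∀ x, HasFDerivAt g (hess x) x)
    (hcont : Continuous hess)
    (xstar : E) (hcrit : g xstar = 0)
    (μ : ℝ) (hμ : 0 < μ)
    (hpd : ∀ u : E, μ * ‖u‖ ^ 2 ≤ ⟪hess xstar u, u⟫)
    (C : ℝ) (hC : 0 < C)
    (hLip : ∀ x ∈ Metric.closedBall xstar (μ / (2 * C)),
      ∀ x' ∈ Metric.closedBall xstar (μ / (2 * C)),
        ‖hess x - hess x'‖ ≤ C * ‖x - x'‖) :
    ∀ x : E, ‖x - xstar‖ ≤ μ / (2 * C) →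
      IsUnit (hess x) ∧
        ‖x - Ring.inverse (hess x) (g x) - xstar‖ ≤ C / μ * ‖x - xstar‖ ^ 2 := by
  intro x hx
  have hμC : 0 < μ / (2 * C) := by positivity
  have hxs : xstar ∈ Metric.closedBall xstar (μ / (2 * C)) :=
    Metric.mem_closedBall_self hμC.le
  have hxb : x ∈ Metric.closedBall xstar (μ / (2 * C)) := by
    rw [mem_closedBall_iff_norm]; exact hx
  have hCr : C * ‖x - xstar‖ ≤ μ / 2 := by
    calc C * ‖x - xstar‖ ≤ C * (μ / (2 * C)) := by gcongr
      _ = μ / 2 := by field_simp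
  -- coercivity of the Hessian at x
  have hco : ∀ u : E, μ / 2 * ‖u‖ ≤ ‖hess x u‖ := by
    intro u
    have h1 := hpd u
    have h2 : ‖(hess x - hess xstar) u‖ ≤ μ / 2 * ‖u‖ :=
      ((hess x - hess xstar).le_opNorm u).trans (by
        gcongr
        exact (hLip x hxb xstar hxs).trans hCr)
    have h3 : μ * ‖u‖ ≤ ‖hess xstar u‖ := by
      have h4 := h1.trans (real_inner_le_norm (hess xstar u) u)
      rcases (norm_nonneg u).eq_or_lt with h0 | h0
      · rw [← h0]; simp
      · refine le_of_mul_le_mul_right ?_ h0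
        nlinarith
    have h5 : ‖hess xstar u‖ ≤ ‖hess x u‖ + ‖(hess x - hess xstar) u‖ := by
      have := norm_sub_le (hess x u) ((hess x - hess xstar) u)
      simpa using this
    linarith
  have hinj : Function.Injective (hess x) := by
    rw [injective_iff_map_eq_zero]
    intro u hu
    have := hco u
    rw [hu, norm_zero] at this
    have h0 := norm_nonneg u
    have : ‖u‖ = 0 := by nlinarith
    exact norm_eq_zero.mp this
  have : CompleteSpace E := FiniteDimensional.complete ℝ E
  have hunit : IsUnit (hess x) := by
    rw [ContinuousLinearMap.isUnit_iff_bijective]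
    exact ⟨hinj, (LinearMap.injective_iff_surjective (f := (hess x : E →ₗ[ℝ] E))).mp hinj⟩
  refine ⟨hunit, ?_⟩
  -- Taylor estimate
  have htay : ‖hess x (x - xstar) - g x‖ ≤ C / 2 * ‖x - xstar‖ ^ 2 := by
    set d := xstar - x with hd
    have hdn : ‖d‖ = ‖x - xstar‖ := norm_sub_rev _ _
    have hder : ∀ t : ℝ, HasDerivAt (fun t : ℝ => g (x + t • d) - t • hess x d - g x)
        (hess (x + t • d) d - hess x d) t := by
      intro t
      have hp : HasDerivAt (fun t : ℝ => x + t • d) d t := by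
        simpa using ((hasDerivAt_id t).smul_const d).const_add x
      have h1 := (hhess (x + t • d)).comp_hasDerivAt t hp
      have h2 : HasDerivAt (fun t : ℝ => t • hess x d) (hess x d) t := by
        simpa using (hasDerivAt_id t).smul_const (hess x d)
      exact (h1.sub h2).sub_const (g x)
    have hB : ∀ t : ℝ, HasDerivAt (fun t : ℝ => C / 2 * ‖d‖ ^ 2 * t ^ 2)
        (C * ‖d‖ ^ 2 * t) t := by
      intro t
      have := (hasDerivAt_pow 2 t).const_mul (C / 2 * ‖d‖ ^ 2)
      refine this.congr_deriv ?_
      norm_num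
      ring
    have key := image_norm_le_of_norm_deriv_right_le_deriv_boundary
      (f := fun t : ℝ => g (x + t • d) - t • hess x d - g x) (a := 0) (b := 1)
      (fun t _ => (hder t).continuousAt.continuousWithinAt)
      (fun t _ => (hder t).hasDerivWithinAt)
      (B := fun t : ℝ => C / 2 * ‖d‖ ^ 2 * t ^ 2) (by simp) hB
      (by
        intro t ht
        have hmem : x + t • d ∈ Metric.closedBall xstar (μ / (2 * C)) := by
          have := (convex_closedBall xstar (μ / (2 * C))).add_smul_sub_mem hxb hxs
            ⟨ht.1, ht.2.le⟩
          simpa [hd] using this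
        have h1 := hLip _ hmem x hxb
        have h2 : ‖x + t • d - x‖ = t * ‖d‖ := by
          rw [add_sub_cancel_left, norm_smul, Real.norm_of_nonneg ht.1]
        rw [h2] at h1
        calc ‖hess (x + t • d) d - hess x d‖ = ‖(hess (x + t • d) - hess x) d‖ := by simp
          _ ≤ ‖hess (x + t • d) - hess x‖ * ‖d‖ := ContinuousLinearMap.le_opNorm _ _
          _ ≤ C * (t * ‖d‖) * ‖d‖ := by gcongr
          _ = C * ‖d‖ ^ 2 * t := by ring)
      (Set.right_mem_Icc.mpr zero_le_one)
    have e : hess x (x - xstar) - g x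
        = g (x + (1 : ℝ) • d) - (1 : ℝ) • hess x d - g x := by
      rw [one_smul, one_smul, hd, add_sub_cancel, hcrit, map_sub, map_sub]
      abel
    rw [e, ← hdn]
    simpa using key
  have hmul : hess x (Ring.inverse (hess x) (g x)) = g x := by
    have := Ring.mul_inverse_cancel _ hunit
    exact congrArg (fun T : E →L[ℝ] E => T (g x)) this
  have h1 := hco (x - Ring.inverse (hess x) (g x) - xstar)
  have h2 : hess x (x - Ring.inverse (hess x) (g x) - xstar)
      = hess x (x - xstar) - g x := by
    rw [map_sub, map_sub, hmul, map_sub]; abel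
  rw [h2] at h1
  have h3 := h1.trans htay
  have h4 : μ / 2 * (C / μ * ‖x - xstar‖ ^ 2) = C / 2 * ‖x - xstar‖ ^ 2 := by
    field_simp
  rw [← h4] at h3
  exact le_of_mul_le_mul_left h3 (by positivity)
end

section
/- Let E be a finite-dimensional real inner product space, let U ⊆ E be an open convex set, and let f : E → ℝ be twice differentiable on U with Hessian ∇²f Lipschitz on U with constant C ≥ 0 (in operator norm). Let x₁, x₂ ∈ U, set s := x₂ − x₁ and y := ∇f(x₂) − ∇f(x₁), and let B : E → E be any continuous linear map. Then the secant residual satisfies ‖y − B s‖ ≤ (‖∇²f(x₁) − B‖ + (C/2) ‖s‖) ‖s‖, where ‖∇²f(x₁) − B‖ is the operator norm. -/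
/-- Secant residual bound: if the Hessian of `f` is `C`-Lipschitz on an open convex
set `U`, then for `x₁, x₂ ∈ U`, `s = x₂ - x₁`, `y = ∇f(x₂) - ∇f(x₁)` and any
continuous linear map `B`, `‖y - B s‖ ≤ (‖∇²f(x₁) - B‖ + (C/2)‖s‖) ‖s‖`. -/
theorem secant_residual_le
    {E : Type*} [NormedAddCommGroup E] [InnerProductSpace ℝ E]
    [FiniteDimensional ℝ E]
    (U : Set E) (hU : IsOpen U) (hUconv : Convex ℝ U)
    (f : E → ℝ) (g : E → E) (hess : E → E →L[ℝ] E)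
    (hg : ∀ x ∈ U, HasGradientAt f (g x) x)
    (hhess : ∀ x ∈ U, HasFDerivAt g (hess x) x)
    (C : ℝ) (hC : 0 ≤ C)
    (hLip : ∀ x ∈ U, ∀ x' ∈ U, ‖hess x - hess x'‖ ≤ C * ‖x - x'‖)
    (x₁ x₂ : E) (hx₁ : x₁ ∈ U) (hx₂ : x₂ ∈ U)
    (B : E →L[ℝ] E) :
    ‖(g x₂ - g x₁) - B (x₂ - x₁)‖
      ≤ (‖hess x₁ - B‖ + C / 2 * ‖x₂ - x₁‖) * ‖x₂ - x₁‖ := by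
  have hmem : ∀ t ∈ Set.Icc (0:ℝ) 1, x₁ + t • (x₂ - x₁) ∈ U := fun t ht =>
    hUconv.add_smul_sub_mem hx₁ hx₂ ht
  have hd : ∀ t ∈ Set.Icc (0:ℝ) 1,
      HasDerivAt (fun t : ℝ => g (x₁ + t • (x₂ - x₁)) - g x₁ - t • B (x₂ - x₁))
        (hess (x₁ + t • (x₂ - x₁)) (x₂ - x₁) - B (x₂ - x₁)) t := by
    intro t ht
    have h1 : HasDerivAt (fun t : ℝ => x₁ + t • (x₂ - x₁)) (x₂ - x₁) t := by
      simpa using ((hasDerivAt_id t).smul_const (x₂ - x₁)).const_add x₁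
    have h2 : HasDerivAt (fun t : ℝ => t • B (x₂ - x₁)) (B (x₂ - x₁)) t := by
      simpa using (hasDerivAt_id t).smul_const (B (x₂ - x₁))
    exact (((hhess _ (hmem t ht)).comp_hasDerivAt t h1).sub_const (g x₁)).sub h2
  have key := image_norm_le_of_norm_deriv_right_le_deriv_boundary (a := 0) (b := 1)
    (f := fun t : ℝ => g (x₁ + t • (x₂ - x₁)) - g x₁ - t • B (x₂ - x₁))
    (f' := fun t : ℝ => hess (x₁ + t • (x₂ - x₁)) (x₂ - x₁) - B (x₂ - x₁))
    (B := fun t : ℝ => (‖hess x₁ - B‖ * t + C / 2 * ‖x₂ - x₁‖ * t ^ 2) * ‖x₂ - x₁‖)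
    (B' := fun t : ℝ => (‖hess x₁ - B‖ + C * ‖x₂ - x₁‖ * t) * ‖x₂ - x₁‖)
    (fun t ht => (hd t ht).continuousAt.continuousWithinAt)
    (fun t ht => (hd t (Set.Ico_subset_Icc_self ht)).hasDerivWithinAt)
    (by simp) ?_ ?_ (Set.right_mem_Icc.2 zero_le_one)
  · simpa using key
  · intro t
    have h := ((((hasDerivAt_id t).const_mul ‖hess x₁ - B‖).add
      ((hasDerivAt_pow 2 t).const_mul (C / 2 * ‖x₂ - x₁‖))).mul_const ‖x₂ - x₁‖)
    refine h.congr_deriv ?_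
    simp only [Nat.cast_ofNat, Nat.add_one_sub_one, pow_one, show 2 - 1 = 1 from rfl]
    ring
  · intro t ht
    have hL := hLip _ (hmem t (Set.Ico_subset_Icc_self ht)) x₁ hx₁
    rw [add_sub_cancel_left, norm_smul, Real.norm_of_nonneg ht.1] at hL
    have h3 : ‖hess (x₁ + t • (x₂ - x₁)) - B‖ ≤ ‖hess x₁ - B‖ + C * ‖x₂ - x₁‖ * t := by
      have := norm_sub_le_norm_sub_add_norm_sub (hess (x₁ + t • (x₂ - x₁))) (hess x₁) B
      linarith
    exact ((hess (x₁ + t • (x₂ - x₁)) - B).le_opNorm (x₂ - x₁)).trans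
      (mul_le_mul_of_nonneg_right h3 (norm_nonneg _))
end
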